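/- Let e, k ≥ 1 be natural numbers, λ : Fin e → ℝ, δ > 0, 0 < s ≤ S real storage caps, and α > 0 a real number. Suppose t ≥ 0 and p ∈ ℕ satisfy ∑_{j=1}^e min(⌊(t − λ_j)^+/δ⌋, s) = p, and suppose m_1, …, m_v are positive integers with v ≥ k and ∑_{i=1}^v m_i ≤ p. Then t + α·∑_{i=1}^v 1/m_i ≥ min_{p' ∈ ℕ, k ≤ p' ≤ ⌊e·S⌋} ( inf{ t' ≥ 0 : ∑_{j=1}^e min(⌊(t' − λ_j)^+/δ⌋, S) ≥ p' } + α·F(k, p') ). (This is the deterministic core of Theorem 1 of the paper: for any coding scheme and any realization of the straggling times, the sum of computation latency and downlink communication latency when users decode is lower-bounded by min_{p'} (L̄_c(λ, p') + L̄_d^u(p')); taking expectations over λ yields the stated bound on τ_u.) -/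

import Mathlib

/-- `F(k, p)` from Lemma 2: `k²/p` if `k ∣ p`, and otherwise
`(⌈p/k⌉·k − p)/⌊p/k⌋ + (p − k·⌊p/k⌋)/⌈p/k⌉`. -/
noncomputable def commLatencyBound (k p : ℕ) : ℝ :=
  if k ∣ p then (k : ℝ) ^ 2 / p
  else ((⌈(p : ℝ) / k⌉ : ℤ) * k - p) / ((⌊(p : ℝ) / k⌋ : ℤ) : ℝ)
    + ((p : ℝ) - k * ((⌊(p : ℝ) / k⌋ : ℤ) : ℝ)) / ((⌈(p : ℝ) / k⌉ : ℤ) : ℝ)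

theorem commLatencyBound_nonneg {k : ℕ} (hk : 0 < k) (p : ℕ) : 0 ≤ commLatencyBound k p := by
  unfold commLatencyBound
  split_ifs with h
  · positivity
  · have hk' : (0 : ℝ) < k := by exact_mod_cast hk
    have hpk : (0 : ℝ) ≤ (p : ℝ) / k := by positivity
    have hf : (0 : ℝ) ≤ (⌊(p : ℝ) / k⌋ : ℤ) := by exact_mod_cast Int.floor_nonneg.2 hpk
    have hc : (0 : ℝ) ≤ (⌈(p : ℝ) / k⌉ : ℤ) := by exact_mod_cast Int.ceil_nonneg hpk
    have h1 := (div_le_iff₀ hk').1 (Int.le_ceil ((p : ℝ) / k))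
    have h2 := (le_div_iff₀ hk').1 (Int.floor_le ((p : ℝ) / k))
    exact add_nonneg (div_nonneg (by linarith) hf) (div_nonneg (by linarith) hc)

theorem commLatencyBound_eq {k p : ℕ} (hk : 0 < k) (hkp : k ≤ p) :
    commLatencyBound k p = k / ((p / k : ℕ) : ℝ) -
      (p - k * ((p / k : ℕ) : ℝ)) / (((p / k : ℕ) : ℝ) * (((p / k : ℕ) : ℝ) + 1)) := by
  have hk' : (0 : ℝ) < k := by exact_mod_cast hk
  have hq : (0 : ℝ) < ((p / k : ℕ) : ℝ) := by exact_mod_cast Nat.div_pos hkp hk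
  have hfloor : ⌊(p : ℝ) / k⌋ = ((p / k : ℕ) : ℤ) := by
    rw [← Nat.floor_div_eq_div (K := ℝ), Int.natCast_floor_eq_floor (by positivity)]
  unfold commLatencyBound
  split_ifs with h
  · obtain ⟨c, rfl⟩ := h
    rw [Nat.mul_div_cancel_left _ hk] at hq ⊢
    push_cast
    field_simp
    ring
  · have hceil : ⌈(p : ℝ) / k⌉ = ((p / k : ℕ) : ℤ) + 1 := by
      rw [Int.ceil_eq_iff, Int.cast_add, Int.cast_natCast, Int.cast_one]
      constructor
      · rw [lt_div_iff₀ hk']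
        have h1 : p / k * k < p :=
          lt_of_le_of_ne (Nat.div_mul_le_self p k) fun h' => h ⟨p / k, by rw [mul_comm, h']⟩
        have h2 : ((p / k : ℕ) : ℝ) * k < p := by exact_mod_cast h1
        linarith
      · have h1 := Int.lt_floor_add_one ((p : ℝ) / k)
        rw [hfloor] at h1
        rw [Int.cast_natCast] at h1
        exact h1.le
    rw [hfloor, hceil, Int.cast_add, Int.cast_natCast, Int.cast_one]
    field_simp
    ring

/-- On positive integers, `1 / x` lies above its chord through `q` and `q + 1`. -/
theorem one_div_natCast_ge_chord {q n : ℕ} (hq : 0 < q) (hn : 0 < n) :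
    (1 : ℝ) / q - ((n : ℝ) - q) / (q * (q + 1)) ≤ 1 / n := by
  have hq' : (0 : ℝ) < q := by exact_mod_cast hq
  have hn' : (0 : ℝ) < n := by exact_mod_cast hn
  have key : (0 : ℝ) ≤ ((n : ℝ) - q) * (n - q - 1) := by
    rcases le_or_gt n q with h | h
    · have : (n : ℝ) ≤ q := by exact_mod_cast h
      nlinarith
    · have : (q : ℝ) + 1 ≤ n := by exact_mod_cast h
      exact mul_nonneg (by linarith) (by linarith)
  have : (1 : ℝ) / n - (1 / q - ((n : ℝ) - q) / (q * (q + 1))) =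
      ((n : ℝ) - q) * (n - q - 1) / (n * (q * (q + 1))) := by
    field_simp
    ring
  have : 0 ≤ ((n : ℝ) - q) * (n - q - 1) / (n * (q * (q + 1))) := by positivity
  linarith

theorem commLatencyBound_le_sum_one_div {ι : Type*} [Fintype ι] {k p : ℕ} (hk : 0 < k)
    (hcard : k ≤ Fintype.card ι) (m : ι → ℕ) (hm : ∀ i, 0 < m i) (hsum : ∑ i, m i ≤ p) :
    commLatencyBound k p ≤ ∑ i, (1 : ℝ) / m i := by
  have hkp : k ≤ p := by
    calc k ≤ ∑ _i : ι, 1 := by simpa using hcard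
      _ ≤ ∑ i, m i := Finset.sum_le_sum fun i _ => hm i
      _ ≤ p := hsum
  have hq : 0 < p / k := Nat.div_pos hkp hk
  rw [commLatencyBound_eq hk hkp]
  set q := p / k
  have hq' : (0 : ℝ) < q := by exact_mod_cast hq
  obtain ⟨T, -, hT⟩ := Finset.exists_subset_card_eq (s := (Finset.univ : Finset ι)) hcard
  have hTsum : ∑ i ∈ T, (m i : ℝ) ≤ p := by
    exact_mod_cast (Finset.sum_le_univ_sum_of_nonneg fun i => (m i).zero_le).trans hsum
  calc (k : ℝ) / q - (p - k * q) / (q * (q + 1))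
      ≤ k / q - (∑ i ∈ T, (m i : ℝ) - k * q) / (q * (q + 1)) := by gcongr
    _ = ∑ i ∈ T, ((1 : ℝ) / q - ((m i : ℝ) - q) / (q * (q + 1))) := by
        rw [Finset.sum_sub_distrib, ← Finset.sum_div, ← Finset.sum_div, Finset.sum_sub_distrib]
        simp [hT, div_eq_mul_inv]
    _ ≤ ∑ i ∈ T, (1 : ℝ) / m i :=
        Finset.sum_le_sum fun i _ => one_div_natCast_ge_chord hq (hm i)
    _ ≤ ∑ i, (1 : ℝ) / m i := Finset.sum_le_univ_sum_of_nonneg fun i => by positivity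

/-- **Deterministic core of Theorem 1 (users decode).** If at time `t` the `e`
edge servers with straggling times `lam`, per-product time `δ` and per-server
cap `s ≤ S` have computed exactly `p` products, and `v ≥ k` distinct products
with positive spatial diversities `m₁, …, m_v`, `∑ mᵢ ≤ p`, are transmitted
with downlink latency `α·∑ 1/mᵢ`, then the total
`t + α·∑ 1/mᵢ` is at least
`min_{k ≤ p' ≤ ⌊e·S⌋} ( L̄_c(λ, p') + α·F(k, p') )`. -/
theorem total_latency_lower_bound_users_decode
    (e k : ℕ) (he : 1 ≤ e) (hk : 1 ≤ k)
    (lam : Fin e → ℝ) (δ : ℝ) (hδ : 0 < δ)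
    (s S : ℝ) (hs : 0 < s) (hsS : s ≤ S)
    (α : ℝ) (hα : 0 < α)
    (t : ℝ) (ht : 0 ≤ t) (p : ℕ)
    (hp : ∑ j : Fin e, min ((⌊(max (t - lam j) 0) / δ⌋ : ℤ) : ℝ) s = (p : ℝ))
    (v : ℕ) (hv : k ≤ v) (m : Fin v → ℕ) (hm : ∀ i, 0 < m i)
    (hsum : ∑ i, m i ≤ p) :
    t + α * ∑ i, (1 : ℝ) / (m i : ℝ) ≥
      sInf {x : ℝ | ∃ p' : ℕ, k ≤ p' ∧ (p' : ℤ) ≤ ⌊(e : ℝ) * S⌋ ∧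
        x = sInf {t' : ℝ | 0 ≤ t' ∧
              (p' : ℝ) ≤ ∑ j : Fin e, min ((⌊(max (t' - lam j) 0) / δ⌋ : ℤ) : ℝ) S}
            + α * commLatencyBound k p'} := by
  have hpS : (p : ℝ) ≤ ∑ j : Fin e, min ((⌊(max (t - lam j) 0) / δ⌋ : ℤ) : ℝ) S := by
    rw [← hp]
    gcongr
  have hpe : (p : ℝ) ≤ e * S :=
    hpS.trans ((Finset.sum_le_sum fun j _ => min_le_right _ _).trans_eq (by simp))
  have hkp : k ≤ p := by
    calc k ≤ v := hv
      _ = ∑ _i : Fin v, 1 := by simp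
      _ ≤ ∑ i, m i := Finset.sum_le_sum fun i _ => hm i
      _ ≤ p := hsum
  have hpfloor : (p : ℤ) ≤ ⌊(e : ℝ) * S⌋ := Int.le_floor.2 (by exact_mod_cast hpe)
  refine csInf_le_of_le (b := sInf {t' : ℝ | 0 ≤ t' ∧
      (p : ℝ) ≤ ∑ j : Fin e, min ((⌊(max (t' - lam j) 0) / δ⌋ : ℤ) : ℝ) S}
        + α * commLatencyBound k p) ?_ ⟨p, hkp, hpfloor, rfl⟩ ?_
  · refine ⟨0, ?_⟩
    rintro x ⟨p', -, -, rfl⟩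
    exact add_nonneg (Real.sInf_nonneg fun _ h => h.1)
      (mul_nonneg hα.le (commLatencyBound_nonneg hk p'))
  · gcongr
    · exact csInf_le ⟨0, fun _ h => h.1⟩ ⟨ht, hpS⟩
    · exact commLatencyBound_le_sum_one_div hk (by simpa using hv) m hm hsum
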